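/- Let K be a separable metric space and let f : K → ℝ be a bounded function which is upper semicontinuous or lower semicontinuous and satisfies lim_{ε→0⁺} ε·i(f,ε) = 0. Then f ∈ SD(K). -/

import Mathlib

open Filter Topology Set

noncomputable section

/-- A real-valued function is bounded. -/
def BddFun {X : Type*} (f : X → ℝ) : Prop := ∃ C, ∀ x, |f x| ≤ C

/-- `f ∈ DBSC(X)`: `f` is a difference of bounded lower semicontinuous functions. -/
def MemDBSC {X : Type*} [TopologicalSpace X] (f : X → ℝ) : Prop :=
  ∃ u v : X → ℝ, BddFun u ∧ BddFun v ∧ LowerSemicontinuous u ∧ LowerSemicontinuous v ∧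
    f = u - v

/-- The D-norm of `f`. -/
def DNorm {X : Type*} [TopologicalSpace X] (f : X → ℝ) : ℝ :=
  sInf {c | ∃ φ : ℕ → X → ℝ, (∀ j, Continuous (φ j)) ∧ (∀ x, Summable fun j => |φ j x|) ∧
    (∀ x, ∑' j, φ j x = f x) ∧ (∀ x, ∑' j, |φ j x| ≤ c)}

/-- The sup-norm of `f`. -/
def supNorm {X : Type*} (f : X → ℝ) : ℝ := ⨆ x, |f x|

/-- A simple D-function: a D-function taking finitely many values. -/
def SimpleD {X : Type*} [TopologicalSpace X] (f : X → ℝ) : Prop :=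
  MemDBSC f ∧ (Set.range f).Finite

/-- `f ∈ SD(X)`: `f` is a strong D-function. -/
def MemSD {X : Type*} [TopologicalSpace X] (f : X → ℝ) : Prop :=
  ∃ φ : ℕ → X → ℝ, (∀ n, SimpleD (φ n)) ∧
    Tendsto (fun n => DNorm (f - φ n)) atTop (𝓝 0)

/-- `f ∈ B_{1/2}(X)`: `f` is a uniform limit of D-functions. -/
def MemBHalf {X : Type*} [TopologicalSpace X] (f : X → ℝ) : Prop :=
  ∃ g : ℕ → X → ℝ, (∀ n, MemDBSC (g n)) ∧ TendstoUniformly g f atTop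

/-- The upper semicontinuous envelope `Uf`. -/
def uEnv {X : Type*} [TopologicalSpace X] (f : X → ℝ) (x : X) : ℝ :=
  sInf {c | ∃ V : Set X, IsOpen V ∧ x ∈ V ∧ sSup (f '' V) = c}

/-- The lower oscillation of `f` at `x`. -/
def losc {X : Type*} [TopologicalSpace X] (f : X → ℝ) (x : X) : ℝ :=
  sInf {c | ∃ V : Set X, IsOpen V ∧ x ∈ V ∧ sSup ((fun y => |f y - f x|) '' V) = c}

/-- The oscillation of `f`: `osc f = U (losc f)`. -/
def osc {X : Type*} [TopologicalSpace X] (f : X → ℝ) : X → ℝ := uEnv (losc f)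

/-- The oscillation sets `os_n(f, ε)`. -/
def osSet {X : Type*} [TopologicalSpace X] (f : X → ℝ) (ε : ℝ) : ℕ → Set X
  | 0 => Set.univ
  | n + 1 => {x | ∃ h : x ∈ osSet f ε n, ε ≤ osc ((osSet f ε n).restrict f) ⟨x, h⟩}

/-- The `ε`-oscillation index `i(f, ε) = sup {n : os_n(f,ε) ≠ ∅}`. -/
def oscIndex {X : Type*} [TopologicalSpace X] (f : X → ℝ) (ε : ℝ) : ℕ∞ :=
  ⨆ (m : ℕ) (_ : (osSet f ε m).Nonempty), (m : ℕ∞)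

/-- `f` has finite Baire index. -/
def FiniteBaireIndex {X : Type*} [TopologicalSpace X] (f : X → ℝ) : Prop :=
  ∃ n : ℕ, ∀ ε > 0, osSet f ε n = ∅

/-- The Baire index `i(f) = sup_{ε > 0} i(f, ε)`. -/
def baireIndex {X : Type*} [TopologicalSpace X] (f : X → ℝ) : ℕ∞ :=
  ⨆ (ε : ℝ) (_ : 0 < ε), oscIndex f ε

open scoped ENNReal

/-! ### Lower semicontinuous functions and the D-norm -/

lemma UpperSemicontinuous.neg_lowerSemicontinuous {X : Type*} [TopologicalSpace X] {f : X → ℝ}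
    (hf : UpperSemicontinuous f) : LowerSemicontinuous (-f) := by
  intro x a ha
  have ha' : a < -f x := ha
  filter_upwards [hf x (-a) (by linarith)] with y hy
  show a < -f y
  linarith

/-- A nonnegative lower semicontinuous function on a metric space is the sum of a series of
nonnegative continuous functions. -/
lemma LowerSemicontinuous.exists_hasSum_continuous {K : Type*} [MetricSpace K] {u : K → ℝ}
    (hu : LowerSemicontinuous u) (h0 : ∀ x, 0 ≤ u x) :
    ∃ a : ℕ → K → ℝ, (∀ j, Continuous (a j)) ∧ (∀ j x, 0 ≤ a j x) ∧
      ∀ x, HasSum (fun j => a j x) (u x) := by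
  set w : ℕ → K → ℝ := fun n x => ⨅ y, (u y + n * dist x y)
  have hnn : ∀ (n : ℕ) x y, 0 ≤ u y + n * dist x y := fun n x y => by
    have := h0 y
    positivity
  have hbdd : ∀ (n : ℕ) x, BddBelow (range fun y => u y + n * dist x y) := fun n x =>
    ⟨0, by rintro _ ⟨y, rfl⟩; exact hnn n x y⟩
  have hwc : ∀ n, Continuous (w n) := by
    intro n
    refine (LipschitzWith.of_le_add_mul (n : NNReal) fun x x' => ?_).continuous
    rw [← sub_le_iff_le_add]
    have : Nonempty K := ⟨x⟩
    refine le_ciInf fun y => ?_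
    rw [sub_le_iff_le_add]
    refine (ciInf_le (hbdd n x) y).trans ?_
    have h1 := mul_le_mul_of_nonneg_left (dist_triangle x x' y) (Nat.cast_nonneg (α := ℝ) n)
    simp only [NNReal.coe_natCast]
    linarith
  have hw0 : ∀ n x, 0 ≤ w n x := fun n x => Real.iInf_nonneg (hnn n x)
  have hwu : ∀ n x, w n x ≤ u x := fun n x => by
    simpa using ciInf_le (hbdd n x) x
  have hmono : ∀ n x, w n x ≤ w (n + 1) x := fun n x => by
    refine ciInf_mono (hbdd n x) fun y => ?_
    have : (0 : ℝ) ≤ dist x y := dist_nonneg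
    push_cast
    linarith
  have hlim : ∀ x, Tendsto (fun n => w n x) atTop (𝓝 (u x)) := by
    intro x
    have : Nonempty K := ⟨x⟩
    refine tendsto_order.2 ⟨fun a ha => ?_, fun a ha => .of_forall fun n => (hwu n x).trans_lt ha⟩
    obtain ⟨b, hab, hb⟩ := exists_between ha
    obtain ⟨r, hr, hrb⟩ := Metric.eventually_nhds_iff.1 (hu x b hb)
    filter_upwards [eventually_ge_atTop ⌈b / r⌉₊] with n hn
    refine hab.trans_le (le_ciInf fun y => ?_)
    by_cases hy : dist y x < r
    · have := (hrb hy).le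
      have : (0 : ℝ) ≤ n * dist x y := by positivity
      linarith
    · have h1 : b ≤ n * r := (div_le_iff₀ hr).1 (Nat.ceil_le.1 hn)
      have h2 : (n : ℝ) * r ≤ n * dist x y :=
        mul_le_mul_of_nonneg_left (by rw [dist_comm]; exact not_lt.1 hy) n.cast_nonneg
      linarith [h0 y]
  set W : ℕ → K → ℝ := fun n x => min (n : ℝ) (w n x) with hW
  refine ⟨fun n x => W (n + 1) x - W n x, fun n => ?_, fun n x => ?_, fun x => ?_⟩
  · exact (continuous_const.min (hwc _)).sub (continuous_const.min (hwc _))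
  · exact sub_nonneg.2 (min_le_min (by simp) (hmono n x))
  · refine (hasSum_iff_tendsto_nat_of_nonneg (fun n => ?_) _).2 ?_
    · exact sub_nonneg.2 (min_le_min (by simp) (hmono n x))
    · have : ∀ n, ∑ i ∈ Finset.range n, (W (i + 1) x - W i x) = W n x := fun n => by
        rw [Finset.sum_range_sub (fun i => W i x)]
        simp [hW, hw0 0 x]
      simp only [this]
      refine (hlim x).congr' ?_
      filter_upwards [eventually_ge_atTop ⌈u x⌉₊] with n hn
      exact (min_eq_right ((hwu n x).trans (Nat.ceil_le.1 hn))).symm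

lemma DNorm_of_isEmpty {X : Type*} [TopologicalSpace X] [IsEmpty X] (f : X → ℝ) :
    DNorm f = 0 := by
  have : {c : ℝ | ∃ φ : ℕ → X → ℝ, (∀ j, Continuous (φ j)) ∧
      (∀ x, Summable fun j => |φ j x|) ∧ (∀ x, ∑' j, φ j x = f x) ∧
      (∀ x, ∑' j, |φ j x| ≤ c)} = univ :=
    eq_univ_of_forall fun c => ⟨fun _ => f, fun _ => continuous_of_const fun x => isEmptyElim x,
      fun x => isEmptyElim x, fun x => isEmptyElim x, fun x => isEmptyElim x⟩
  rw [DNorm, this, Real.sInf_univ]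

lemma DNorm_nonneg {X : Type*} [TopologicalSpace X] (f : X → ℝ) : 0 ≤ DNorm f := by
  rcases isEmpty_or_nonempty X with h | ⟨⟨x⟩⟩
  · exact (DNorm_of_isEmpty f).ge
  · refine Real.sInf_nonneg ?_
    rintro c ⟨φ, -, -, -, hc⟩
    exact (tsum_nonneg fun j => abs_nonneg _).trans (hc x)

lemma DNorm_sub_le {K : Type*} [MetricSpace K] {u v : K → ℝ} {c : ℝ}
    (hc : 0 ≤ c) (hu : LowerSemicontinuous u) (hv : LowerSemicontinuous v) (hu0 : ∀ x, 0 ≤ u x)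
    (hv0 : ∀ x, 0 ≤ v x) (huv : ∀ x, u x + v x ≤ c) : DNorm (u - v) ≤ c := by
  rcases isEmpty_or_nonempty K with h | ⟨⟨x₀⟩⟩
  · rwa [DNorm_of_isEmpty]
  obtain ⟨a, hac, ha0, ha⟩ := hu.exists_hasSum_continuous hu0
  obtain ⟨b, hbc, hb0, hb⟩ := hv.exists_hasSum_continuous hv0
  have hle : ∀ j x, |a j x - b j x| ≤ a j x + b j x := fun j x =>
    abs_le.2 ⟨by linarith [ha0 j x], by linarith [hb0 j x]⟩
  have hsum : ∀ x, Summable fun j => |a j x - b j x| := fun x =>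
    ((ha x).add (hb x)).summable.of_nonneg_of_le (fun _ => abs_nonneg _) fun j => hle j x
  refine csInf_le ⟨0, ?_⟩ ⟨fun j x => a j x - b j x, fun j => (hac j).sub (hbc j), hsum,
    fun x => ((ha x).sub (hb x)).tsum_eq, fun x => ?_⟩
  · rintro d ⟨φ, -, -, -, hd⟩
    exact (tsum_nonneg fun j => abs_nonneg _).trans (hd x₀)
  · refine ((hsum x).tsum_le_tsum (fun j => hle j x) ((ha x).add (hb x)).summable).trans ?_
    rw [((ha x).add (hb x)).tsum_eq]
    exact huv x

/-- If every `η > 0` admits a simple D-function at D-distance at most `η` from `f`, then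
`f ∈ SD(X)`. -/
lemma memSD_of_forall_exists {X : Type*} [TopologicalSpace X] {f : X → ℝ}
    (h : ∀ η > 0, ∃ φ, SimpleD φ ∧ DNorm (f - φ) ≤ η) : MemSD f := by
  choose φ hφ hle using fun n : ℕ => h (1 / ((n : ℝ) + 1)) (by positivity)
  exact ⟨φ, hφ, squeeze_zero (fun _ => DNorm_nonneg _) hle
    tendsto_one_div_add_atTop_nhds_zero_nat⟩

/-! ### Oscillation -/

lemma BddFun.exists_abs_sub_le {X : Type*} {f : X → ℝ} (hf : BddFun f) :
    ∃ C, ∀ x y, |f y - f x| ≤ C := by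
  obtain ⟨C, hC⟩ := hf
  exact ⟨C + C, fun x y => (abs_sub _ _).trans (add_le_add (hC y) (hC x))⟩

section Oscillation

variable {X : Type*} [TopologicalSpace X] {f : X → ℝ}

lemma losc_nonneg (f : X → ℝ) (x : X) : 0 ≤ losc f x := by
  refine Real.sInf_nonneg ?_
  rintro c ⟨V, -, -, rfl⟩
  refine Real.sSup_nonneg ?_
  rintro _ ⟨y, -, rfl⟩
  exact abs_nonneg _

lemma losc_le_sSup (f : X → ℝ) {x : X} {V : Set X} (hV : IsOpen V) (hx : x ∈ V) :
    losc f x ≤ sSup ((fun y => |f y - f x|) '' V) := by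
  refine csInf_le ⟨0, ?_⟩ ⟨V, hV, hx, rfl⟩
  rintro c ⟨V, -, -, rfl⟩
  refine Real.sSup_nonneg ?_
  rintro _ ⟨y, -, rfl⟩
  exact abs_nonneg _

lemma osc_le_sSup (f : X → ℝ) {x : X} {V : Set X} (hV : IsOpen V) (hx : x ∈ V) :
    osc f x ≤ sSup (losc f '' V) := by
  refine csInf_le ⟨0, ?_⟩ ⟨V, hV, hx, rfl⟩
  rintro c ⟨V, -, -, rfl⟩
  refine Real.sSup_nonneg ?_
  rintro _ ⟨y, -, rfl⟩
  exact losc_nonneg f y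

lemma exists_isOpen_of_losc_lt {x : X} {ε : ℝ} (h : losc f x < ε) :
    ∃ V, IsOpen V ∧ x ∈ V ∧ sSup ((fun y => |f y - f x|) '' V) < ε := by
  rw [losc] at h
  obtain ⟨c, ⟨V, hV, hx, rfl⟩, hc⟩ := exists_lt_of_csInf_lt
    (by exact ⟨_, univ, isOpen_univ, mem_univ x, rfl⟩) h
  exact ⟨V, hV, hx, hc⟩

lemma exists_isOpen_of_osc_lt {x : X} {ε : ℝ} (h : osc f x < ε) :
    ∃ V, IsOpen V ∧ x ∈ V ∧ sSup (losc f '' V) < ε := by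
  rw [osc, uEnv] at h
  obtain ⟨c, ⟨V, hV, hx, rfl⟩, hc⟩ := exists_lt_of_csInf_lt
    (by exact ⟨_, univ, isOpen_univ, mem_univ x, rfl⟩) h
  exact ⟨V, hV, hx, hc⟩

lemma bddAbove_losc_image (hf : BddFun f) (V : Set X) : BddAbove (losc f '' V) := by
  obtain ⟨C, hC⟩ := hf.exists_abs_sub_le
  refine ⟨C, ?_⟩
  rintro _ ⟨x, -, rfl⟩
  refine (losc_le_sSup f isOpen_univ (mem_univ x)).trans (csSup_le ⟨_, x, mem_univ x, rfl⟩ ?_)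
  rintro _ ⟨y, -, rfl⟩
  exact hC x y

lemma losc_le_osc (hf : BddFun f) (x : X) : losc f x ≤ osc f x := by
  refine le_of_forall_gt fun ε h => ?_
  obtain ⟨V, -, hx, hV⟩ := exists_isOpen_of_osc_lt h
  exact (le_csSup (bddAbove_losc_image hf V) ⟨x, hx, rfl⟩).trans_lt hV

lemma eventually_osc_lt {x : X} {ε : ℝ} (h : osc f x < ε) : ∀ᶠ y in 𝓝 x, osc f y < ε := by
  obtain ⟨V, hV, hx, hc⟩ := exists_isOpen_of_osc_lt h
  filter_upwards [hV.mem_nhds hx] with y hy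
  exact (osc_le_sSup f hV hy).trans_lt hc

lemma eventually_abs_sub_lt_of_osc_lt (hf : BddFun f) {x : X} {ε : ℝ} (h : osc f x < ε) :
    ∀ᶠ y in 𝓝 x, |f y - f x| < ε := by
  obtain ⟨V, hV, hx, hc⟩ := exists_isOpen_of_losc_lt ((losc_le_osc hf x).trans_lt h)
  obtain ⟨C, hC⟩ := hf.exists_abs_sub_le
  filter_upwards [hV.mem_nhds hx] with y hy
  refine (le_csSup ⟨C, ?_⟩ (mem_image_of_mem (fun y => |f y - f x|) hy)).trans_lt hc
  rintro _ ⟨z, -, rfl⟩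
  exact hC x z

lemma osSet_succ_subset (f : X → ℝ) (ε : ℝ) (n : ℕ) : osSet f ε (n + 1) ⊆ osSet f ε n :=
  fun _ hx => hx.1

lemma antitone_osSet (f : X → ℝ) (ε : ℝ) : Antitone (osSet f ε) :=
  antitone_nat_of_succ_le (osSet_succ_subset f ε)

lemma isClosed_osSet (f : X → ℝ) (ε : ℝ) (n : ℕ) : IsClosed (osSet f ε n) := by
  induction n with
  | zero => exact isClosed_univ
  | succ n ih =>
    have hc : IsClosed {z : osSet f ε n | ε ≤ osc ((osSet f ε n).domRestrict f) z} := by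
      rw [← isOpen_compl_iff, isOpen_iff_mem_nhds]
      intro z hz
      filter_upwards [eventually_osc_lt (not_le.1 hz)] with y hy
      exact not_le.2 hy
    convert ih.isClosedEmbedding_subtypeVal.isClosedMap _ hc using 1
    ext x
    simp only [osSet, mem_ofPred_eq, mem_image, Subtype.exists, exists_and_right, exists_eq_right]
    rfl

lemma eventually_abs_sub_lt_of_notMem_osSet (hf : BddFun f) {ε : ℝ} {n : ℕ} {x : X}
    (hx : x ∈ osSet f ε n) (hx' : x ∉ osSet f ε (n + 1)) :
    ∀ᶠ y in 𝓝[osSet f ε n] x, |f y - f x| < ε := by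
  have hlt : osc ((osSet f ε n).domRestrict f) ⟨x, hx⟩ < ε := not_le.1 fun h => hx' ⟨hx, h⟩
  have hb : BddFun ((osSet f ε n).domRestrict f) := hf.imp fun C hC z => hC z
  have := eventually_abs_sub_lt_of_osc_lt hb hlt
  rw [nhdsWithin_eq_map_subtype_coe hx]
  exact this

end Oscillation

/-! ### Gluing along the oscillation sets -/

/-- A function that is lower semicontinuous on each level set of an upper semicontinuous rank
function becomes lower semicontinuous after subtracting a large multiple of the rank. -/
lemma lowerSemicontinuous_add_rank {X : Type*} [TopologicalSpace X] {r : X → ℕ} {h : X → ℝ}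
    {c : ℝ} (n : ℝ) (hr : ∀ x, ∀ᶠ y in 𝓝 x, r y ≤ r x) (h0 : ∀ x, 0 ≤ h x) (hc : ∀ x, h x ≤ c)
    (hh : ∀ j, LowerSemicontinuousOn h {x | r x = j}) :
    LowerSemicontinuous fun x => h x + (n - r x) * c := by
  intro x a ha
  have hx : ∀ᶠ y in 𝓝[{y | r y = r x}] x, a - (n - r x) * c < h y :=
    hh (r x) x rfl _ (by linarith)
  filter_upwards [hr x, eventually_nhdsWithin_iff.1 hx] with y hy hy'
  rcases hy.eq_or_lt with he | hlt
  · have := hy' he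
    rw [he]
    linarith
  · have h1 : (r y : ℝ) + 1 ≤ r x := by exact_mod_cast hlt
    have h2 : (n - r x + 1) * c ≤ (n - r y) * c :=
      mul_le_mul_of_nonneg_right (by linarith) ((h0 x).trans (hc x))
    linarith [h0 y, hc x]

lemma lowerSemicontinuous_fract : LowerSemicontinuous (Int.fract : ℝ → ℝ) := by
  intro x a ha
  rw [Int.fract] at ha
  filter_upwards [Iio_mem_nhds (Int.lt_floor_add_one x),
    Ioi_mem_nhds (show a + ⌊x⌋ < x by linarith)] with y hy hy'
  have h1 : ⌊y⌋ ≤ ⌊x⌋ := Int.lt_add_one_iff.1 (Int.floor_lt.2 (by exact_mod_cast hy))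
  have h2 : (⌊y⌋ : ℝ) ≤ ⌊x⌋ := by exact_mod_cast h1
  have h3 : a + ⌊x⌋ < y := hy'
  rw [Int.fract]
  linarith

lemma ContinuousOn.lowerSemicontinuousOn_mul_fract {X : Type*} [TopologicalSpace X] {g : X → ℝ}
    {s : Set X} (hg : ContinuousOn g s) {ε : ℝ} (hε : 0 < ε) :
    LowerSemicontinuousOn (fun x => ε * Int.fract (g x / ε)) s := by
  intro x hx a ha
  have h := lowerSemicontinuous_fract (g x / ε) (a / ε) ((div_lt_iff₀' hε).2 ha)
  filter_upwards [((hg x hx).div_const ε).eventually h] with y hy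
  exact (div_lt_iff₀' hε).1 hy

/-- A function that on each level set of `r` oscillates locally less than `ε` is `ε`-close to a
function that is continuous on each level set. -/
lemma exists_continuousOn_levels {K : Type*} [MetricSpace K] {r : K → ℕ} {f : K → ℝ} {ε : ℝ}
    (h : ∀ x, ∀ᶠ y in 𝓝[{y | r y = r x}] x, |f y - f x| < ε) :
    ∃ g : K → ℝ, (∀ x, |f x - g x| ≤ ε) ∧ ∀ j, ContinuousOn g {x | r x = j} := by
  have key : ∀ j, ∃ g : C({x | r x = j}, ℝ),
      ∀ x : {x | r x = j}, g x ∈ Icc (f x - ε) (f x + ε) := by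
    intro j
    refine exists_continuous_forall_mem_convex_of_local_const (fun x => convex_Icc _ _) ?_
    rintro ⟨x, hx⟩
    obtain rfl : r x = j := hx
    refine ⟨f x, ?_⟩
    have := h x
    rw [nhdsWithin_eq_map_subtype_coe (show x ∈ {y | r y = r x} from rfl)] at this
    filter_upwards [eventually_map.1 this] with y hy
    rw [abs_lt] at hy
    exact ⟨by linarith, by linarith⟩
  choose g hg using key
  refine ⟨fun x => g (r x) ⟨x, rfl⟩, fun x => ?_, fun j => ?_⟩
  · have := hg (r x) ⟨x, rfl⟩
    exact abs_le.2 ⟨by linarith [this.2], by linarith [this.1]⟩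
  · rw [continuousOn_iff_continuous_domRestrict]
    convert (g j).continuous using 1
    ext ⟨x, hx⟩
    obtain rfl : r x = j := hx
    rfl

lemma finite_range_sub_mul_fract {X : Type*} {g : X → ℝ} (hg : BddFun g) {ε : ℝ} (hε : 0 < ε) :
    (range fun x => g x - ε * Int.fract (g x / ε)).Finite := by
  obtain ⟨C, hC⟩ := hg
  refine ((finite_Icc ⌊-C / ε⌋ ⌊C / ε⌋).image fun m : ℤ => ε * (m : ℝ)).subset ?_
  rintro _ ⟨x, rfl⟩
  have := abs_le.1 (hC x)
  refine ⟨⌊g x / ε⌋, ⟨Int.floor_le_floor ?_, Int.floor_le_floor ?_⟩, ?_⟩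
  · gcongr
    exact this.1
  · gcongr
    exact this.2
  · have : ε * (g x / ε) = g x := mul_div_cancel₀ _ hε.ne'
    simp only [Int.fract, mul_sub, this]
    ring

lemma memDBSC_sub_sub {X : Type*} [TopologicalSpace X] {f u v : X → ℝ} (hf : BddFun f)
    (hsc : UpperSemicontinuous f ∨ LowerSemicontinuous f) (hub : BddFun u) (hvb : BddFun v)
    (hu : LowerSemicontinuous u) (hv : LowerSemicontinuous v) : MemDBSC (f - (u - v)) := by
  obtain ⟨A, hA⟩ := hub
  obtain ⟨B, hB⟩ := hvb
  obtain ⟨C, hC⟩ := hf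
  rcases hsc with h | h
  · refine ⟨v, u + -f, ⟨B, hB⟩, ⟨A + C, fun x => ?_⟩, hv, hu.add h.neg_lowerSemicontinuous,
      by abel⟩
    refine (abs_add_le _ _).trans (add_le_add (hA x) ?_)
    rw [Pi.neg_apply, abs_neg]
    exact hC x
  · refine ⟨f + v, u, ⟨C + B, fun x => ?_⟩, ⟨A, hA⟩, h.add hv, hu, by abel⟩
    exact (abs_add_le _ _).trans (add_le_add (hC x) (hB x))

/-- A bounded semicontinuous function that locally oscillates less than `ε` on each level set of an
upper semicontinuous rank function with values in `{0, …, n}` is within `6 (n + 1) ε` of a simple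
D-function in D-norm. -/
lemma exists_simpleD_DNorm_sub_le {K : Type*} [MetricSpace K] {f : K → ℝ} (hb : BddFun f)
    (hsc : UpperSemicontinuous f ∨ LowerSemicontinuous f) {ε : ℝ} (hε : 0 < ε) {n : ℕ}
    {r : K → ℕ} (hrn : ∀ x, r x ≤ n) (hr : ∀ x, ∀ᶠ y in 𝓝 x, r y ≤ r x)
    (hosc : ∀ x, ∀ᶠ y in 𝓝[{y | r y = r x}] x, |f y - f x| < ε) :
    ∃ φ, SimpleD φ ∧ DNorm (f - φ) ≤ 6 * (n + 1) * ε := by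
  obtain ⟨g, hfg, hg⟩ := exists_continuousOn_levels hosc
  have hfr0 : ∀ x, 0 ≤ ε * Int.fract (g x / ε) := fun x =>
    mul_nonneg hε.le (Int.fract_nonneg _)
  have hfr1 : ∀ x, ε * Int.fract (g x / ε) ≤ ε := fun x =>
    mul_le_of_le_one_right hε.le (Int.fract_lt_one _).le
  obtain ⟨p, q, hp0, hp1, hq0, hq1, hp, hq, hpq⟩ : ∃ p q : K → ℝ, (∀ x, 0 ≤ p x) ∧
      (∀ x, p x ≤ 3 * ε) ∧ (∀ x, 0 ≤ q x) ∧ (∀ x, q x ≤ 3 * ε) ∧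
      (∀ j, LowerSemicontinuousOn p {x | r x = j}) ∧
      (∀ j, LowerSemicontinuousOn q {x | r x = j}) ∧
      ∀ x, p x - q x = f x - (g x - ε * Int.fract (g x / ε)) := by
    have hfg' := fun x => abs_le.1 (hfg x)
    have hfract := fun j => (hg j).lowerSemicontinuousOn_mul_fract hε
    have hconst : ∀ j, LowerSemicontinuousOn (fun _ : K => ε) {x | r x = j} := fun j =>
      continuousOn_const.lowerSemicontinuousOn
    rcases hsc with h | h
    · refine ⟨fun x => ε * Int.fract (g x / ε) + ε, fun x => g x + -f x + ε, fun x => ?_,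
        fun x => ?_, fun x => ?_, fun x => ?_, fun j => (hfract j).add (hconst j), fun j =>
        ((hg j).lowerSemicontinuousOn.add
          (h.neg_lowerSemicontinuous.lowerSemicontinuousOn _)).add (hconst j), fun x => ?_⟩
      all_goals linarith [hfr0 x, hfr1 x, (hfg' x).1, (hfg' x).2]
    · refine ⟨fun x => f x + -g x + ε * Int.fract (g x / ε) + ε, fun _ => ε, fun x => ?_,
        fun x => ?_, fun x => ?_, fun x => ?_, fun j =>
        (((h.lowerSemicontinuousOn _).add
          (hg j).neg.lowerSemicontinuousOn).add (hfract j)).add (hconst j), hconst, fun x => ?_⟩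
      all_goals linarith [hfr0 x, hfr1 x, (hfg' x).1, (hfg' x).2]
  set u : K → ℝ := fun x => p x + (n - r x) * (3 * ε) with hu_def
  set v : K → ℝ := fun x => q x + (n - r x) * (3 * ε) with hv_def
  have hu : LowerSemicontinuous u := lowerSemicontinuous_add_rank n hr hp0 hp1 hp
  have hv : LowerSemicontinuous v := lowerSemicontinuous_add_rank n hr hq0 hq1 hq
  have hrk0 : ∀ x, 0 ≤ ((n : ℝ) - r x) * (3 * ε) := fun x =>
    mul_nonneg (sub_nonneg.2 (by exact_mod_cast hrn x)) (by positivity)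
  have hrk1 : ∀ x, ((n : ℝ) - r x) * (3 * ε) ≤ n * (3 * ε) := fun x =>
    mul_le_mul_of_nonneg_right (by simp) (by positivity)
  have hu0 : ∀ x, 0 ≤ u x := fun x => add_nonneg (hp0 x) (hrk0 x)
  have hv0 : ∀ x, 0 ≤ v x := fun x => add_nonneg (hq0 x) (hrk0 x)
  have hu1 : ∀ x, u x ≤ 3 * ε + n * (3 * ε) := fun x => add_le_add (hp1 x) (hrk1 x)
  have hv1 : ∀ x, v x ≤ 3 * ε + n * (3 * ε) := fun x => add_le_add (hq1 x) (hrk1 x)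
  have hφ : ∀ x, (f - (u - v)) x = g x - ε * Int.fract (g x / ε) := fun x => by
    have := hpq x
    simp only [hu_def, hv_def, Pi.sub_apply]
    linarith
  have hgb : BddFun g := by
    obtain ⟨C, hC⟩ := hb
    refine ⟨C + ε, fun x => ?_⟩
    have h1 := abs_le.1 (hC x)
    have h2 := abs_le.1 (hfg x)
    exact abs_le.2 ⟨by linarith, by linarith⟩
  refine ⟨f - (u - v), ⟨memDBSC_sub_sub hb hsc ⟨3 * ε + n * (3 * ε), fun x => ?_⟩
    ⟨3 * ε + n * (3 * ε), fun x => ?_⟩ hu hv, ?_⟩, ?_⟩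
  · rw [abs_of_nonneg (hu0 x)]
    exact hu1 x
  · rw [abs_of_nonneg (hv0 x)]
    exact hv1 x
  · rw [funext hφ]
    exact finite_range_sub_mul_fract hgb hε
  · rw [sub_sub_cancel]
    exact DNorm_sub_le (by positivity) hu hv hu0 hv0 fun x => by linarith [hu1 x, hv1 x]

/-- If `os_{n+1}(f, ε)` is empty, then the level sets of a suitable upper semicontinuous rank
function are the differences of consecutive oscillation sets. -/
lemma exists_rank_of_osSet_eq_empty {X : Type*} [TopologicalSpace X] {f : X → ℝ} (hf : BddFun f)
    {ε : ℝ} {n : ℕ} (hn : osSet f ε (n + 1) = ∅) :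
    ∃ r : X → ℕ, (∀ x, r x ≤ n) ∧ (∀ x, ∀ᶠ y in 𝓝 x, r y ≤ r x) ∧
      ∀ x, ∀ᶠ y in 𝓝[{y | r y = r x}] x, |f y - f x| < ε := by
  classical
  have hex : ∀ x, ∃ j, x ∉ osSet f ε (j + 1) := fun x => ⟨n, by simp [hn]⟩
  have hmem : ∀ x, x ∈ osSet f ε (Nat.find (hex x)) := by
    intro x
    rcases hk : Nat.find (hex x) with _ | k
    · exact mem_univ x
    · exact not_not.1 (Nat.find_min (hex x) (m := k) (by omega))
  refine ⟨fun x => Nat.find (hex x), fun x => Nat.find_min' _ (by simp [hn]), fun x => ?_,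
    fun x => ?_⟩
  · filter_upwards [(isClosed_osSet f ε _).isOpen_compl.mem_nhds (Nat.find_spec (hex x))] with y hy
    exact Nat.find_min' _ hy
  · refine nhdsWithin_mono x (fun y hy => ?_)
      (eventually_abs_sub_lt_of_notMem_osSet hf (hmem x) (Nat.find_spec (hex x)))
    have hy' : Nat.find (hex y) = Nat.find (hex x) := hy
    exact hy' ▸ hmem y

lemma osSet_eq_empty_of_oscIndex_le {X : Type*} [TopologicalSpace X] {f : X → ℝ} {ε : ℝ} {n : ℕ}
    (h : oscIndex f ε ≤ n) : osSet f ε (n + 1) = ∅ := by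
  by_contra hne
  have h1 : ((n + 1 : ℕ) : ℕ∞) ≤ oscIndex f ε :=
    le_iSup₂_of_le (f := fun (m : ℕ) (_ : (osSet f ε m).Nonempty) => (m : ℕ∞)) (n + 1)
      (nonempty_iff_ne_empty.2 hne) le_rfl
  have h2 : n + 1 ≤ n := by exact_mod_cast h1.trans h
  omega

/-- **Theorem 1.4 (b).** If `f` is bounded, semicontinuous, and
`ε · i(f, ε) → 0` as `ε → 0⁺`, then `f ∈ SD(K)`. -/
theorem memSD_of_semicontinuous_of_tendsto {K : Type*} [MetricSpace K]
    [TopologicalSpace.SeparableSpace K] (f : K → ℝ) (hb : BddFun f)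
    (hsc : UpperSemicontinuous f ∨ LowerSemicontinuous f)
    (hlim : Tendsto (fun ε : ℝ => ENNReal.ofReal ε * (oscIndex f ε : ℝ≥0∞))
      (𝓝[>] (0 : ℝ)) (𝓝 0)) :
    MemSD f := by
  refine memSD_of_forall_exists fun η hη => ?_
  obtain ⟨ε, hle, hε0, hεη⟩ : ∃ ε : ℝ,
      ENNReal.ofReal ε * (oscIndex f ε : ℝ≥0∞) < ENNReal.ofReal (η / 12) ∧ 0 < ε ∧ ε < η / 12 := by
    have h1 := hlim.eventually_lt_const (ENNReal.ofReal_pos.2 (show 0 < η / 12 by positivity))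
    have h2 : ∀ᶠ ε : ℝ in 𝓝[>] 0, 0 < ε ∧ ε < η / 12 := Ioo_mem_nhdsGT (by positivity)
    exact (h1.and h2).exists
  have htop : oscIndex f ε ≠ ⊤ := by
    intro h
    rw [h, ENat.toENNReal_top, ENNReal.mul_top (ENNReal.ofReal_pos.2 hε0).ne'] at hle
    exact not_top_lt hle
  obtain ⟨n, hn⟩ := ENat.ne_top_iff_exists.1 htop
  rw [← hn, ENat.toENNReal_coe, ← ENNReal.ofReal_natCast, ← ENNReal.ofReal_mul hε0.le,
    ENNReal.ofReal_lt_ofReal_iff (by positivity)] at hle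
  obtain ⟨r, hrn, hr, hosc⟩ :=
    exists_rank_of_osSet_eq_empty hb (osSet_eq_empty_of_oscIndex_le hn.ge)
  obtain ⟨φ, hφ, hφle⟩ := exists_simpleD_DNorm_sub_le hb hsc hε0 hrn hr hosc
  exact ⟨φ, hφ, hφle.trans (by linarith)⟩
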